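/- Let n ≥ 1 be an integer and β > 3 a real number with 2(n+1)(β−3) − β > 0 and 2β − 3 > 0. Define α_{n+1} := 4(n+1)β/(2(n+1)(β−3) − β) and α̃_{n+2} := 2(n+2)β/(2β−3). Then α_{n+1} > α̃_{n+2} if and only if β < 6(n+1)²/(2n²+n−2). Moreover, for n ≥ 2 the threshold value 6(n+1)²/(2n²+n−2) satisfies 6(n+1)/(2n−1) < 6(n+1)²/(2n²+n−2) < 6n/(2n−3), i.e. it lies in the interior of the interval I_n = (6(n+1)/(2n−1), 6n/(2n−3)]. -/

import Mathlib

/-- **Comparison of `α_{n+1}` and `α̃_{n+2}` and location of the threshold.** For an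
integer `n ≥ 1` and a real `β > 3` with `2(n+1)(β−3) − β > 0` and `2β − 3 > 0`, setting
`α_{n+1} = 4(n+1)β/(2(n+1)(β−3) − β)` and `α̃_{n+2} = 2(n+2)β/(2β−3)`, one has
`α_{n+1} > α̃_{n+2} ↔ β < 6(n+1)²/(2n²+n−2)`; moreover for `n ≥ 2` the threshold
`6(n+1)²/(2n²+n−2)` lies strictly between `6(n+1)/(2n−1)` and `6n/(2n−3)`. -/
theorem alpha_comparison_and_threshold
    (n : ℕ) (hn : 1 ≤ n)
    (β : ℝ) (hβ : 3 < β)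
    (h1 : 0 < 2 * ((n : ℝ) + 1) * (β - 3) - β)
    (h2 : 0 < 2 * β - 3)
    (a at2 : ℝ)
    (ha : a = 4 * ((n : ℝ) + 1) * β / (2 * ((n : ℝ) + 1) * (β - 3) - β))
    (hat2 : at2 = 2 * ((n : ℝ) + 2) * β / (2 * β - 3)) :
    (at2 < a ↔ β < 6 * ((n : ℝ) + 1) ^ 2 / (2 * n ^ 2 + n - 2)) ∧
    (2 ≤ n →
      6 * ((n : ℝ) + 1) / (2 * n - 1) < 6 * ((n : ℝ) + 1) ^ 2 / (2 * n ^ 2 + n - 2) ∧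
      6 * ((n : ℝ) + 1) ^ 2 / (2 * n ^ 2 + n - 2) < 6 * (n : ℝ) / (2 * n - 3)) := by
  have hn' : (1 : ℝ) ≤ n := by exact_mod_cast hn
  have hD : (0 : ℝ) < 2 * n ^ 2 + n - 2 := by nlinarith
  have hβ0 : 0 < 2 * β := by linarith
  refine ⟨?_, fun h => ?_⟩
  · have key : 4 * ((n : ℝ) + 1) * β * (2 * β - 3) -
        2 * ((n : ℝ) + 2) * β * (2 * ((n : ℝ) + 1) * (β - 3) - β) =
        2 * β * (6 * ((n : ℝ) + 1) ^ 2 - β * (2 * n ^ 2 + n - 2)) := by ring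
    rw [ha, hat2, div_lt_div_iff₀ h2 h1, lt_div_iff₀ hD, ← sub_pos, key,
      mul_pos_iff_of_pos_left hβ0, sub_pos]
  · have hn2 : (2 : ℝ) ≤ n := by exact_mod_cast h
    constructor
    · rw [div_lt_div_iff₀ (by linarith) hD]
      nlinarith
    · rw [div_lt_div_iff₀ hD (by linarith)]
      nlinarith
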